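/- arXiv:1203.1601 — 7 statements merged into one kernel-verified Lean document; each statement's English description precedes it below -/
import Mathlib

section
/- Let α : ℝ → EuclideanSpace ℝ (Fin n) be a C³ unit-speed curve (‖α'(s)‖ = 1 for all s), let N : ℝ → EuclideanSpace ℝ (Fin n) satisfy ‖N(s)‖ = 1 for all s, suppose α''(s) = λ(s)·N(s) with λ(s) > 0 for all s (α is a geodesic of the hypersurface with unit normal N), and suppose ⟨N(s), d⟩ = c is constant for a fixed vector d (d is a helix direction). Then the tangent indicatrix β(s) = α'(s) is a curve on the unit sphere S^{n-1} (‖β(s)‖ = 1 for all s), β'(s) ≠ 0 for all s, and the unit tangent vector of β, namely T(s) = β'(s)/‖β'(s)‖, satisfies ⟨T(s), d⟩ = c for all s; that is, the tangent indicatrix of α is a spherical general helix with respect to the same direction d. -/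
open scoped RealInnerProductSpace

/-- The tangent indicatrix `β = α'` of a unit-speed geodesic `α` of a helix hypersurface
lies on the unit sphere, has nonvanishing derivative, and its unit tangent makes the same
constant inner product `c` with the helix direction `d`. -/
theorem stmt1 {n : ℕ} (α N : ℝ → EuclideanSpace ℝ (Fin n))
    (hα : ContDiff ℝ 3 α) (hunit : ∀ s, ‖deriv α s‖ = 1)
    (hN : ∀ s, ‖N s‖ = 1) (l : ℝ → ℝ)
    (hgeo : ∀ s, deriv (deriv α) s = l s • N s) (hl : ∀ s, 0 < l s)
    (d : EuclideanSpace ℝ (Fin n)) (c : ℝ)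
    (hhelix : ∀ s, ⟪N s, d⟫ = c) :
    ∀ s, ‖deriv α s‖ = 1 ∧ deriv (deriv α) s ≠ 0 ∧
      ⟪(‖deriv (deriv α) s‖)⁻¹ • deriv (deriv α) s, d⟫ = c := by
  intro s
  have hnorm : ‖deriv (deriv α) s‖ = l s := by
    rw [hgeo, norm_smul, hN, mul_one, Real.norm_of_nonneg (hl s).le]
  refine ⟨hunit s, ?_, ?_⟩
  · rw [← norm_pos_iff, hnorm]
    exact hl s
  · rw [hnorm, hgeo, inv_smul_smul₀ (hl s).ne', hhelix]
end

section
/- Let β : ℝ → EuclideanSpace ℝ (Fin n) be a C² curve lying on the unit sphere, i.e. ‖β(t)‖ = 1 for all t, and suppose β'(t₀) ≠ 0 for some t₀. If d ∈ EuclideanSpace ℝ (Fin n) is such that t ↦ ⟨β(t), d⟩ is constant with value c ≠ 0, then β is not a geodesic of the unit sphere S^{n-1}: there is no function k : ℝ → ℝ such that β''(t) = k(t)·β(t) for all t. -/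
open scoped RealInnerProductSpace

section Curves

variable {E : Type*} [NormedAddCommGroup E] [InnerProductSpace ℝ E]

/-- If `f` makes a constant inner product with `d`, then its derivative is orthogonal to `d`. -/
theorem inner_deriv_eq_zero_of_inner_const {f : ℝ → E} {d : E} {c : ℝ}
    (hf : Differentiable ℝ f) (hconst : ∀ t, ⟪f t, d⟫ = c) (t : ℝ) : ⟪deriv f t, d⟫ = 0 := by
  have h := (hf t).hasDerivAt.inner ℝ (hasDerivAt_const t d)
  simp only [hconst, inner_zero_right, zero_add] at h
  exact h.unique (hasDerivAt_const t c)

/-- The velocity of a curve of constant norm is orthogonal to its position. -/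
theorem inner_deriv_self_eq_zero_of_norm_const {f : ℝ → E} {r : ℝ}
    (hf : Differentiable ℝ f) (hnorm : ∀ t, ‖f t‖ = r) (t : ℝ) : ⟪deriv f t, f t⟫ = 0 := by
  have h := (hf t).hasDerivAt.norm_sq
  simp only [hnorm] at h
  have h' := h.unique (hasDerivAt_const t (r ^ 2))
  rw [real_inner_comm]
  linarith

/-- For a curve of constant norm, the normal component of the acceleration is determined by
the speed. -/
theorem inner_deriv_deriv_self_of_norm_const {f : ℝ → E} {r : ℝ}
    (hf : Differentiable ℝ f) (hf' : Differentiable ℝ (deriv f)) (hnorm : ∀ t, ‖f t‖ = r)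
    (t : ℝ) : ⟪deriv (deriv f) t, f t⟫ = -‖deriv f t‖ ^ 2 := by
  have h := (hf' t).hasDerivAt.inner ℝ (hf t).hasDerivAt
  simp only [inner_deriv_self_eq_zero_of_norm_const hf hnorm] at h
  have h' := h.unique (hasDerivAt_const t (0 : ℝ))
  rw [real_inner_self_eq_norm_sq] at h'
  linarith

end Curves

/-- A `C²` curve `β` on the unit sphere with `β'(t₀) ≠ 0` somewhere, making a constant
nonzero inner product `c` with a fixed vector `d`, is not a geodesic of the sphere:
its acceleration is not everywhere proportional to the position vector. -/
theorem stmt3 {n : ℕ} (β : ℝ → EuclideanSpace ℝ (Fin n))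
    (hβ : ContDiff ℝ 2 β) (hsph : ∀ t, ‖β t‖ = 1)
    (t₀ : ℝ) (ht₀ : deriv β t₀ ≠ 0)
    (d : EuclideanSpace ℝ (Fin n)) (c : ℝ) (hc : c ≠ 0)
    (hconst : ∀ t, ⟪β t, d⟫ = c) :
    ¬ ∃ k : ℝ → ℝ, ∀ t, deriv (deriv β) t = k t • β t := by
  rintro ⟨k, hk⟩
  have hd : Differentiable ℝ β := hβ.differentiable (by norm_num)
  have hd' : Differentiable ℝ (deriv β) :=
    (contDiff_succ_iff_deriv.mp (show ContDiff ℝ (1 + 1) β by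
      simpa [one_add_one_eq_two] using hβ)).2.2.differentiable one_ne_zero
  have hk₀ : k t₀ = 0 := by
    have h := inner_deriv_eq_zero_of_inner_const hd'
      (inner_deriv_eq_zero_of_inner_const hd hconst) t₀
    rw [hk, real_inner_smul_left, hconst] at h
    exact (mul_eq_zero.mp h).resolve_right hc
  have h := inner_deriv_deriv_self_of_norm_const hd hd' hsph t₀
  rw [hk, hk₀, zero_smul, inner_zero_left] at h
  exact ht₀ (by simpa using h)
end

section
/- Let α : ℝ → EuclideanSpace ℝ (Fin n) be a C³ unit-speed curve (‖α'(s)‖ = 1 for all s), let N : ℝ → EuclideanSpace ℝ (Fin n) be differentiable with ‖N(s)‖ = 1 for all s, suppose α''(s) = λ(s)·N(s) with λ(s) > 0 for all s (α is a geodesic of the hypersurface with unit normal N), and let H ⊆ EuclideanSpace ℝ (Fin n) be a linear subspace such that for every d ∈ H the function s ↦ ⟨N(s), d⟩ is constant (the hypersurface is a strong r-helix with helix-direction space H). Then the principal normal V₂(s) = α''(s)/‖α''(s)‖ is differentiable and for every d ∈ H and every s, ⟨V₂'(s), d⟩ = 0; that is, every helix direction lies in the orthogonal complement of span{V₂'(s)}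 along α. -/
open scoped RealInnerProductSpace

/-- For a unit-speed geodesic `α` of a strong r-helix hypersurface with unit normal `N`
and helix-direction space `H`, the principal normal `V₂ = α''/‖α''‖` is differentiable
and every `d ∈ H` is orthogonal to `V₂'(s)` for all `s`. -/
theorem stmt6 {n : ℕ} (α N : ℝ → EuclideanSpace ℝ (Fin n))
    (hα : ContDiff ℝ 3 α) (hunit : ∀ s, ‖deriv α s‖ = 1)
    (hNdiff : Differentiable ℝ N) (hN : ∀ s, ‖N s‖ = 1) (l : ℝ → ℝ)
    (hgeo : ∀ s, deriv (deriv α) s = l s • N s) (hl : ∀ s, 0 < l s)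
    (H : Submodule ℝ (EuclideanSpace ℝ (Fin n)))
    (hH : ∀ d ∈ H, ∃ c : ℝ, ∀ s, ⟪N s, d⟫ = c) :
    Differentiable ℝ (fun s => (‖deriv (deriv α) s‖)⁻¹ • deriv (deriv α) s) ∧
      ∀ d ∈ H, ∀ s,
        ⟪deriv (fun s => (‖deriv (deriv α) s‖)⁻¹ • deriv (deriv α) s) s, d⟫ = 0 := by
  have hV : (fun s => (‖deriv (deriv α) s‖)⁻¹ • deriv (deriv α) s) = N := by
    funext s
    rw [hgeo s, norm_smul, hN s, mul_one, Real.norm_of_nonneg (hl s).le, smul_smul,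
      inv_mul_cancel₀ (hl s).ne', one_smul]
  rw [hV]
  refine ⟨hNdiff, fun d hd s => ?_⟩
  obtain ⟨c, hc⟩ := hH d hd
  have hderiv := (hNdiff s).hasDerivAt.inner ℝ (hasDerivAt_const s d)
  simp only [hc, inner_zero_right, zero_add] at hderiv
  exact hderiv.unique (hasDerivAt_const s c)
end

section
/- Let α : ℝ → EuclideanSpace ℝ (Fin n) be a C³ unit-speed curve (‖α'(s)‖ = 1 for all s), let N : ℝ → EuclideanSpace ℝ (Fin n) be differentiable with ‖N(s)‖ = 1 for all s, suppose α''(s) = λ(s)·N(s) with λ(s) > 0 for all s (α is a geodesic of the hypersurface with unit normal N), and let d be a fixed vector such that s ↦ ⟨N(s), d⟩ is constant (the hypersurface is a helix with direction d). Then the principal normal V₂(s) = α''(s)/‖α''(s)‖ satisfies ⟨V₂'(s), d⟩ = 0 for all s; that is, d lies in the orthogonal complement of span{V₂'(s)} along α. -/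
open scoped RealInnerProductSpace

/-- For a unit-speed geodesic `α` of a helix hypersurface with unit normal `N` and
fixed helix direction `d`, the principal normal `V₂ = α''/‖α''‖` satisfies
`⟪V₂'(s), d⟫ = 0` for all `s`. -/
theorem stmt7 {n : ℕ} (α N : ℝ → EuclideanSpace ℝ (Fin n))
    (hα : ContDiff ℝ 3 α) (hunit : ∀ s, ‖deriv α s‖ = 1)
    (hNdiff : Differentiable ℝ N) (hN : ∀ s, ‖N s‖ = 1) (l : ℝ → ℝ)
    (hgeo : ∀ s, deriv (deriv α) s = l s • N s) (hl : ∀ s, 0 < l s)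
    (d : EuclideanSpace ℝ (Fin n)) (c : ℝ)
    (hhelix : ∀ s, ⟪N s, d⟫ = c) :
    ∀ s, ⟪deriv (fun s => (‖deriv (deriv α) s‖)⁻¹ • deriv (deriv α) s) s, d⟫ = 0 := by
  intro s
  have hV : (fun s => (‖deriv (deriv α) s‖)⁻¹ • deriv (deriv α) s) = N := by
    funext t
    rw [hgeo t, norm_smul, hN t, mul_one, Real.norm_of_nonneg (hl t).le, smul_smul,
      inv_mul_cancel₀ (hl t).ne', one_smul]
  rw [hV]
  have h : HasDerivAt (fun t => ⟪N t, d⟫) (⟪N s, (0 : EuclideanSpace ℝ (Fin n))⟫ + ⟪deriv N s, d⟫) s :=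
    (hNdiff s).hasDerivAt.inner ℝ (hasDerivAt_const s d)
  rw [funext hhelix, inner_zero_right, zero_add] at h
  exact h.unique (hasDerivAt_const s c)
end

section
/- Let α : ℝ → EuclideanSpace ℝ (Fin n) be a C² unit-speed curve (‖α'(s)‖ = 1 for all s), let N : ℝ → EuclideanSpace ℝ (Fin n) be differentiable with ‖N(s)‖ = 1 and ⟨N(s), α'(s)⟩ = 0 for all s (N is the unit normal of a hypersurface along α), let θ ∈ ℝ with cos θ ≠ 0, and suppose there is a fixed helix direction d such that d = cos θ · N(s) + sin θ · α'(s) for all s (d lies in span{V₁(s), N(s)} along α, making a constant angle θ ∉ {0, π/2} with N). Then ⟨N'(s), α'(s)⟩ = 0 for all s; that is, α is an asymptotic curve on the hypersurface. -/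
open scoped RealInnerProductSpace

/-- A differentiable curve of constant norm is orthogonal to its derivative. -/
theorem inner_deriv_self_eq_zero_of_norm_eq {E : Type*} [NormedAddCommGroup E]
    [InnerProductSpace ℝ E] {f : ℝ → E} {s r : ℝ} (hf : DifferentiableAt ℝ f s)
    (hr : ∀ t, ‖f t‖ = r) : ⟪deriv f s, f s⟫ = 0 := by
  have h := hf.hasDerivAt.norm_sq
  simp only [hr] at h
  have h0 := h.unique (hasDerivAt_const s (r ^ 2))
  rw [real_inner_comm]
  linarith

/-- If a fixed helix direction `d` lies in `span{α'(s), N(s)}` along `α`, making a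
constant angle `θ` with `cos θ ≠ 0` with the unit normal `N`, then `α` is an
asymptotic curve: `⟪N'(s), α'(s)⟫ = 0` for all `s`. -/
theorem stmt8 {n : ℕ} (α N : ℝ → EuclideanSpace ℝ (Fin n))
    (hα : ContDiff ℝ 2 α) (hunit : ∀ s, ‖deriv α s‖ = 1)
    (hNdiff : Differentiable ℝ N) (hN : ∀ s, ‖N s‖ = 1)
    (hNtang : ∀ s, ⟪N s, deriv α s⟫ = 0)
    (θ : ℝ) (hθ : Real.cos θ ≠ 0)
    (d : EuclideanSpace ℝ (Fin n))
    (hd : ∀ s, d = Real.cos θ • N s + Real.sin θ • deriv α s) :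
    ∀ s, ⟪deriv N s, deriv α s⟫ = 0 := by
  intro s
  have hα' : DifferentiableAt ℝ (deriv α) s :=
    (hα.differentiable_deriv_two) s
  have hderiv : Real.cos θ • deriv N s + Real.sin θ • deriv (deriv α) s = 0 := by
    have h := ((hNdiff s).hasDerivAt.const_smul (Real.cos θ)).add
      (hα'.hasDerivAt.const_smul (Real.sin θ))
    refine h.unique ((hasDerivAt_const s d).congr_of_eventuallyEq ?_)
    exact .of_forall fun t => (hd t).symm
  have h := congrArg (fun v => ⟪v, deriv α s⟫) hderiv
  simpa [inner_add_left, real_inner_smul_left,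
    inner_deriv_self_eq_zero_of_norm_eq hα' hunit, hθ] using h
end

section
/- Let α : ℝ → EuclideanSpace ℝ (Fin n) be a C² unit-speed curve (‖α'(s)‖ = 1 for all s), let N : ℝ → EuclideanSpace ℝ (Fin n) be differentiable with ‖N(s)‖ = 1 and ⟨N(s), α'(s)⟩ = 0 for all s (N is the unit normal of a hypersurface along α), suppose α''(s) = λ(s)·N(s) for all s (α is a geodesic of the hypersurface), let θ ∈ ℝ with cos θ ≠ 0, and suppose there is a fixed helix direction d such that d = cos θ · N(s) + sin θ · α'(s) for all s. Then α''(s) = 0 for all s; that is, α is a straight line: α(s) = α(0) + s·α'(0) for all s. -/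
open scoped RealInnerProductSpace

/-- If moreover `α` is a geodesic (`α'' = λ • N`) and a fixed helix direction `d` with
`cos θ ≠ 0` lies in `span{α'(s), N(s)}` along `α`, then `α` is a straight line. -/
theorem stmt9 {n : ℕ} (α N : ℝ → EuclideanSpace ℝ (Fin n))
    (hα : ContDiff ℝ 2 α) (hunit : ∀ s, ‖deriv α s‖ = 1)
    (hNdiff : Differentiable ℝ N) (hN : ∀ s, ‖N s‖ = 1)
    (hNtang : ∀ s, ⟪N s, deriv α s⟫ = 0)
    (l : ℝ → ℝ) (hgeo : ∀ s, deriv (deriv α) s = l s • N s)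
    (θ : ℝ) (hθ : Real.cos θ ≠ 0)
    (d : EuclideanSpace ℝ (Fin n))
    (hd : ∀ s, d = Real.cos θ • N s + Real.sin θ • deriv α s) :
    (∀ s, deriv (deriv α) s = 0) ∧ ∀ s : ℝ, α s = α 0 + s • deriv α 0 := by
  have hT : Differentiable ℝ (deriv α) :=
    ((contDiff_succ_iff_deriv (n := 1)).1 hα).2.2.differentiable one_ne_zero
  have hzero : ∀ s, deriv (deriv α) s = 0 := by
    intro s
    have hN' := (hNdiff s).hasDerivAt
    have hT' := (hT s).hasDerivAt
    rw [hgeo s] at hT'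
    have hconst : Real.cos θ • deriv N s + Real.sin θ • l s • N s = 0 := by
      refine HasDerivAt.unique ((hN'.const_smul (Real.cos θ)).add
        (hT'.const_smul (Real.sin θ))) ?_
      exact (hasDerivAt_const s d).congr_of_eventuallyEq
        (Filter.Eventually.of_forall fun t => (hd t).symm)
    have hasymp : ⟪deriv N s, deriv α s⟫ = 0 := by
      have h := congrArg (fun v => ⟪v, deriv α s⟫) hconst
      simpa [inner_add_left, real_inner_smul_left, hNtang s, hθ] using h
    have hl : ⟪N s, l s • N s⟫ + ⟪deriv N s, deriv α s⟫ = 0 := by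
      refine HasDerivAt.unique (hN'.inner ℝ hT') ?_
      exact (hasDerivAt_const s (0 : ℝ)).congr_of_eventuallyEq
        (Filter.Eventually.of_forall hNtang)
    rw [hasymp, real_inner_smul_right, real_inner_self_eq_norm_sq, hN s] at hl
    have hl0 : l s = 0 := by linarith
    rw [hgeo s, hl0, zero_smul]
  refine ⟨hzero, fun s => ?_⟩
  have hTconst : ∀ t, deriv α t = deriv α 0 := fun t =>
    is_const_of_deriv_eq_zero hT hzero t 0
  have hline : ∀ t, HasDerivAt (fun t => α t - t • deriv α 0) 0 t := by
    intro t
    have h := (hα.differentiable two_ne_zero t).hasDerivAt.sub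
      ((hasDerivAt_id t).smul_const (deriv α 0))
    rwa [hTconst t, one_smul, sub_self] at h
  have h := is_const_of_deriv_eq_zero (fun t => (hline t).differentiableAt)
    (fun t => (hline t).deriv) s 0
  simp only [zero_smul, sub_zero] at h
  exact sub_eq_iff_eq_add.1 h
end

section
/- Let α : ℝ → EuclideanSpace ℝ (Fin n) be a C² unit-speed curve (‖α'(s)‖ = 1 for all s), let N : ℝ → EuclideanSpace ℝ (Fin n) be differentiable with ‖N(s)‖ = 1 and ⟨N(s), α'(s)⟩ = 0 for all s (N is the unit normal of a hypersurface along α), suppose α is a line of curvature, i.e. N'(s) = μ(s)·α'(s) for some function μ and all s, let θ ∈ ℝ with cos θ ≠ 0 and sin θ ≠ 0, and suppose there is a fixed helix direction d such that d = cos θ · N(s) + sin θ · α'(s) for all s. Then α''(s) = 0 for all s; that is, α is a straight line: α(s) = α(0) + s·α'(0) for all s. -/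
open scoped RealInnerProductSpace

/-- If `α` is a line of curvature (`N' = μ • α'`) and a fixed helix direction `d` with
`cos θ ≠ 0`, `sin θ ≠ 0` lies in `span{α'(s), N(s)}` along `α`, then `α` is a straight
line. -/
theorem stmt10 {n : ℕ} (α N : ℝ → EuclideanSpace ℝ (Fin n))
    (hα : ContDiff ℝ 2 α) (hunit : ∀ s, ‖deriv α s‖ = 1)
    (hNdiff : Differentiable ℝ N) (hN : ∀ s, ‖N s‖ = 1)
    (hNtang : ∀ s, ⟪N s, deriv α s⟫ = 0)
    (μ : ℝ → ℝ) (hcurv : ∀ s, deriv N s = μ s • deriv α s)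
    (θ : ℝ) (hcos : Real.cos θ ≠ 0) (hsin : Real.sin θ ≠ 0)
    (d : EuclideanSpace ℝ (Fin n))
    (hd : ∀ s, d = Real.cos θ • N s + Real.sin θ • deriv α s) :
    (∀ s, deriv (deriv α) s = 0) ∧ ∀ s : ℝ, α s = α 0 + s • deriv α 0 := by
  have hTdiff : Differentiable ℝ (deriv α) :=
    (hα.iterate_deriv' 1 1).differentiable one_ne_zero
  have hT0 : ∀ s, deriv (deriv α) s = 0 := by
    intro s
    have hT := (hTdiff s).hasDerivAt
    have horth : ⟪deriv α s, deriv (deriv α) s⟫ = 0 := by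
      have hconst : (fun t => ⟪deriv α t, deriv α t⟫) = fun _ => (1 : ℝ) := by
        funext t
        rw [real_inner_self_eq_norm_sq, hunit, one_pow]
      have hinner := hT.inner ℝ hT
      rw [hconst, real_inner_comm (deriv α s) (deriv (deriv α) s)] at hinner
      have := hinner.unique (hasDerivAt_const s (1 : ℝ))
      linarith
    have hsum : Real.cos θ • deriv N s + Real.sin θ • deriv (deriv α) s = 0 := by
      have h := ((hNdiff s).hasDerivAt.const_smul (Real.cos θ)).add
        (hT.const_smul (Real.sin θ))
      have hconst : (Real.cos θ • N + Real.sin θ • deriv α) = fun _ => d :=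
        funext fun t => (hd t).symm
      rw [hconst] at h
      exact h.unique (hasDerivAt_const s d)
    have hμ : μ s = 0 := by
      have h := congrArg (fun v => ⟪deriv α s, v⟫) hsum
      simpa [hcurv, inner_add_right, inner_smul_right, horth, hunit, hcos] using h
    simpa [hcurv, hμ, hsin] using hsum
  refine ⟨hT0, fun s => ?_⟩
  have hTconst : ∀ t, deriv α t = deriv α 0 := fun t =>
    is_const_of_deriv_eq_zero hTdiff hT0 t 0
  have hderiv : ∀ t, HasDerivAt (fun t => α t - t • deriv α 0) 0 t := by
    intro t
    have h := (hα.differentiable two_ne_zero t).hasDerivAt.sub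
      ((hasDerivAt_id t).smul_const (deriv α 0))
    rw [hTconst t, one_smul, sub_self] at h
    exact h
  have h := is_const_of_deriv_eq_zero (fun t => (hderiv t).differentiableAt)
    (fun t => (hderiv t).deriv) s 0
  rw [zero_smul, sub_zero] at h
  exact sub_eq_iff_eq_add.mp h
end
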